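/- arXiv:1711.00980 — 2 statements merged into one kernel-verified Lean document; each statement's English description precedes it below -/
import Mathlib

section
/- Let k be a perfect field of characteristic p > 0, K a field extension of k, n ≥ 1, and b ∈ K with b ≠ 0. Let a ∈ W_n(K) be a Witt vector each of whose coefficients lies in b·k[b], i.e. for each 0 ≤ i ≤ n−1 there exists c_i in the k-subalgebra of K generated by b with a.coeff i = b·c_i. Let Ω be an algebraic closure of K, let α = (α_0,…,α_{n−1}) ∈ W_n(Ω) satisfy F(α) − α = a, and let L = K(α_0,…,α_{n−1}) be the intermediate field of Ω/K generated by the coefficients of α. Then L is a finite extension of K and b lies in the image of the norm map N_{L/K} : L^× → K^×. (This is the statement that the Artin–Schreier–Witt symbol [a, b)_{p^n} vanishes.) -/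
noncomputable section

namespace TruncatedWittVector

variable {p n : ℕ} [hp : Fact p.Prime] {R : Type*} [CommRing R]

/-- Frobenius on truncated Witt vectors (in characteristic `p` it raises each
coefficient to the `p`-th power). -/
def frob (x : TruncatedWittVector p n R) : TruncatedWittVector p n R :=
  WittVector.truncate n (WittVector.frobenius x.out)

end TruncatedWittVector

open Polynomial in
theorem prod_add_zmod_val {p : ℕ} [Fact p.Prime] {R : Type*} [CommRing R] [CharP R p] (y : R) :
    ∏ j : ZMod p, (y + (j.val : R)) = y ^ p - y := by
  have h : (∏ j : ZMod p, (X - C j) : (ZMod p)[X]) = X ^ p - X := by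
    have hroots := FiniteField.roots_X_pow_card_sub_X (ZMod p)
    have hdeg := FiniteField.X_pow_card_sub_X_natDegree_eq (ZMod p)
      (Fact.out (p := p.Prime)).one_lt
    rw [ZMod.card] at hroots
    have hmonic : (X ^ p - X : (ZMod p)[X]).Monic :=
      monic_X_pow_sub (by simpa using (Fact.out (p := p.Prime)).one_lt)
    rw [← prod_multiset_X_sub_C_of_monic_of_roots_card_eq hmonic
      (by rw [hroots, hdeg]; simp [ZMod.card]), hroots]
    rfl
  have h' := congrArg (eval₂ (ZMod.castHom dvd_rfl R) y) h
  simp only [eval₂_finsetProd, eval₂_sub, eval₂_X, eval₂_C, eval₂_X_pow] at h'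
  rw [← h']
  refine Fintype.prod_equiv (Equiv.neg _) _ _ fun j => ?_
  simp [ZMod.natCast_val]

theorem exists_intCast_eq_of_pow_eq_self {p : ℕ} [Fact p.Prime] {R : Type*} [CommRing R]
    [IsDomain R] [CharP R p] {x : R} (hx : x ^ p = x) : ∃ j : ℤ, (j : R) = x := by
  have hprod := prod_add_zmod_val (p := p) x
  rw [hx, sub_self, Finset.prod_eq_zero_iff] at hprod
  obtain ⟨j, -, hj⟩ := hprod
  exact ⟨-j.val, by push_cast; linear_combination -hj⟩

namespace WittVector

variable {p : ℕ} [Fact p.Prime] {R S : Type*} [CommRing R] [CommRing S]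

variable (p R) in
/-- The ideal `V^n W(R)` of Witt vectors whose first `n` coefficients vanish. -/
noncomputable abbrev filtration (n : ℕ) : Ideal (WittVector p R) :=
  RingHom.ker (truncate n : WittVector p R →+* TruncatedWittVector p n R)

theorem mem_filtration_sub_iff {n : ℕ} {x y : WittVector p R} :
    x - y ∈ filtration p R n ↔ ∀ i < n, x.coeff i = y.coeff i := by
  rw [RingHom.mem_ker, map_sub, sub_eq_zero, TruncatedWittVector.ext_iff]
  simp only [coeff_truncate]
  exact Fin.forall_iff

theorem sub_coeff_zero (x y : WittVector p R) :
    (x - y).coeff 0 = x.coeff 0 - y.coeff 0 :=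
  map_sub (constantCoeff : WittVector p R →+* R) x y

theorem intCast_coeff_zero (m : ℤ) : (m : WittVector p R).coeff 0 = m :=
  map_intCast (constantCoeff : WittVector p R →+* R) m

theorem exists_eq_verschiebung {x : WittVector p R} (hx : x.coeff 0 = 0) :
    ∃ y, x = verschiebung y := by
  refine ⟨x.shift 1, ?_⟩
  have := verschiebung_shift x 0 (by simpa using hx)
  rw [this]
  ext i
  simp [shift_coeff]

theorem verschiebung_mem_filtration_succ {n : ℕ} {x : WittVector p R} :
    verschiebung x ∈ filtration p R (n + 1) ↔ x ∈ filtration p R n := by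
  simp only [filtration, mem_ker_truncate]
  constructor
  · intro h i hi
    simpa using h (i + 1) (by lia)
  · rintro h (_ | i) hi
    · simp
    · simpa using h i (by lia)

theorem coeff_zero_of_mem_filtration_succ {n : ℕ} {x : WittVector p R}
    (hx : x ∈ filtration p R (n + 1)) : x.coeff 0 = 0 :=
  (mem_ker_truncate _ _).1 hx 0 n.succ_pos

theorem mem_filtration_zero (x : WittVector p R) : x ∈ filtration p R 0 :=
  (mem_ker_truncate _ _).2 fun _ h => absurd h (Nat.not_lt_zero _)

theorem map_mem_filtration (f : R →+* S) {n : ℕ} {x : WittVector p R}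
    (hx : x ∈ filtration p R n) : map f x ∈ filtration p S n := by
  simp only [filtration, mem_ker_truncate] at hx ⊢
  intro i hi
  simp [map_coeff, hx i hi]

theorem frobenius_map [CharP R p] [CharP S p] (f : R →+* S) (x : WittVector p R) :
    frobenius (map f x) = map f (frobenius x) := by
  ext i
  simp only [coeff_frobenius_charP, map_coeff, map_pow]

theorem frobenius_teichmuller [CharP R p] (r : R) :
    frobenius (teichmuller p r) = teichmuller p (r ^ p) := by
  rw [frobenius_eq_map_frobenius, map_teichmuller]
  rfl

theorem verschiebung_intCast [CharP R p] (m : ℤ) :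
    verschiebung (m : WittVector p R) = ((p * m : ℤ) : WittVector p R) := by
  have h := verschiebung_frobenius (m : WittVector p R)
  rw [map_intCast] at h
  rw [h]
  push_cast
  ring

theorem exists_eq_teichmuller_add_verschiebung (x : WittVector p R) :
    ∃ y, x = teichmuller p (x.coeff 0) + verschiebung y := by
  obtain ⟨y, hy⟩ := exists_eq_verschiebung
    (x := x - teichmuller p (x.coeff 0)) (by simp [sub_coeff_zero])
  exact ⟨y, by rw [← hy]; ring⟩

theorem intCast_mem_filtration [CharP R p] [Nontrivial R] {n : ℕ} {m : ℤ} :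
    (m : WittVector p R) ∈ filtration p R n ↔ (p : ℤ) ^ n ∣ m := by
  induction n generalizing m with
  | zero => simpa using mem_filtration_zero (m : WittVector p R)
  | succ n ih =>
    constructor
    · intro h
      have h0 := coeff_zero_of_mem_filtration_succ h
      rw [intCast_coeff_zero, CharP.intCast_eq_zero_iff R p] at h0
      obtain ⟨l, rfl⟩ := h0
      rw [← verschiebung_intCast, verschiebung_mem_filtration_succ, ih] at h
      rw [pow_succ']
      exact mul_dvd_mul_left _ h
    · rintro ⟨l, rfl⟩
      rw [pow_succ', mul_assoc, ← verschiebung_intCast, verschiebung_mem_filtration_succ, ih]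
      exact dvd_mul_right _ _

theorem exists_intCast_of_frobenius_sub_mem [CharP R p] [IsDomain R] {n : ℕ}
    {x : WittVector p R} (hx : frobenius x - x ∈ filtration p R n) :
    ∃ m : ℤ, x - (m : WittVector p R) ∈ filtration p R n := by
  induction n generalizing x with
  | zero => exact ⟨0, mem_filtration_zero _⟩
  | succ n ih =>
    have h0 := coeff_zero_of_mem_filtration_succ hx
    rw [sub_coeff_zero, coeff_frobenius_charP, sub_eq_zero] at h0
    obtain ⟨j, hj⟩ := exists_intCast_eq_of_pow_eq_self h0
    obtain ⟨y, hy⟩ := exists_eq_verschiebung (x := x - (j : WittVector p R))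
      (by rw [sub_coeff_zero, intCast_coeff_zero, hj, sub_self])
    have hxy : frobenius x - x = verschiebung (frobenius y - y) := by
      rw [map_sub, verschiebung_frobenius_comm, ← hy, map_sub, map_intCast]
      ring
    rw [hxy, verschiebung_mem_filtration_succ] at hx
    obtain ⟨m, hm⟩ := ih hx
    refine ⟨j + p * m, ?_⟩
    have : x - ((j + p * m : ℤ) : WittVector p R) = verschiebung (y - (m : WittVector p R)) := by
      rw [map_sub, ← hy, verschiebung_intCast]
      push_cast
      ring
    rwa [this, verschiebung_mem_filtration_succ]

theorem exists_frobenius_sub_sub_mem {F : Type*} [Field F] [CharP F p] [IsSepClosed F]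
    (n : ℕ) (a : WittVector p F) :
    ∃ x : WittVector p F, frobenius x - x - a ∈ filtration p F n := by
  induction n generalizing a with
  | zero => exact ⟨0, mem_filtration_zero _⟩
  | succ n ih =>
    obtain ⟨y, hy⟩ : ∃ y : F, y ^ p - y = a.coeff 0 := by
      obtain ⟨y, hy⟩ := IsSepClosed.exists_root_C_mul_X_pow_add_C_mul_X_add_C' p p
        (1 : F) (-1) (-a.coeff 0) dvd_rfl (Fact.out (p := p.Prime)).two_le (by simp)
      exact ⟨y, by linear_combination hy⟩
    obtain ⟨b, hb⟩ := exists_eq_verschiebung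
      (x := a - (frobenius (teichmuller p y) - teichmuller p y))
      (by rw [sub_coeff_zero, sub_coeff_zero, frobenius_teichmuller, teichmuller_coeff_zero,
        teichmuller_coeff_zero, hy, sub_self])
    obtain ⟨x, hx⟩ := ih b
    refine ⟨teichmuller p y + verschiebung x, ?_⟩
    have : frobenius (teichmuller p y + verschiebung x) - (teichmuller p y + verschiebung x) - a
        = verschiebung (frobenius x - x - b) := by
      rw [map_sub, map_sub, ← hb, map_add, verschiebung_frobenius_comm]
      ring
    rwa [this, verschiebung_mem_filtration_succ]

theorem exists_teichmuller_add (x y : R) :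
    ∃ g : WittVector p R,
      teichmuller p (x + y) = teichmuller p x + teichmuller p y + verschiebung g := by
  obtain ⟨g, hg⟩ := exists_eq_verschiebung
    (x := teichmuller p (x + y) - teichmuller p x - teichmuller p y)
    (by simp [sub_coeff_zero])
  exact ⟨g, by rw [← hg]; ring⟩

end WittVector

section Cocycles

open WittVector

variable {p : ℕ} [Fact p.Prime] {G M : Type*} [Group G] [Field M] [MulSemiringAction G M]

/-- The coefficientwise action of `σ` on Witt vectors. -/
noncomputable abbrev wittAct (p : ℕ) [Fact p.Prime] {G : Type*} {M : Type*} [Group G] [Field M]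
    [MulSemiringAction G M] (σ : G) : WittVector p M →+* WittVector p M :=
  WittVector.map (MulSemiringAction.toRingHom G M σ)

theorem wittAct_mul (σ τ : G) (x : WittVector p M) :
    wittAct p (σ * τ) x = wittAct p σ (wittAct p τ x) := by
  ext i
  simp [map_coeff, mul_smul]

theorem wittAct_one (x : WittVector p M) : wittAct p (1 : G) x = x := by
  ext i
  simp [map_coeff]

/-- `σ ∈ H` translates `α` by the integer `m`, in Witt vectors of length `n`. -/
def IsTranslation (n : ℕ) (H : Subgroup G) (α : WittVector p M) (σ : G) (m : ℤ) : Prop :=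
  σ ∈ H ∧ wittAct p σ α - α - (m : WittVector p M) ∈ filtration p M n

/-- The class of the cup product of the character `σ ↦ σ α - α` of `H` with `b` is trivial,
witnessed by a `1`-cocycle `v` on the group of pairs `(σ, m)` with `σ α = α + m` whose value at
`(1, p ^ n)` is `b` and which is trivial at `(σ, 0)` for `σ` fixing a finite set `S`. -/
def IsSplit (n : ℕ) (H : Subgroup G) (α : WittVector p M) (b : M) : Prop :=
  ∃ (v : G → ℤ → M) (S : Set M), S.Finite ∧ (∀ σ m, v σ m ≠ 0) ∧
    (∀ σ m τ l, IsTranslation n H α σ m → IsTranslation n H α τ l →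
      v (σ * τ) (m + l) = v σ m * σ • v τ l) ∧
    v 1 (p ^ n : ℕ) = b ∧
    ∀ σ, IsTranslation n H α σ 0 → (∀ s ∈ S, σ • s = s) → v σ 0 = 1

namespace IsTranslation

variable {n : ℕ} {H : Subgroup G} {α : WittVector p M} {σ τ : G} {m l : ℤ}

theorem mul (hσ : IsTranslation n H α σ m) (hτ : IsTranslation n H α τ l) :
    IsTranslation n H α (σ * τ) (m + l) := by
  refine ⟨H.mul_mem hσ.1 hτ.1, ?_⟩
  have h := (filtration p M n).add_mem
    (map_mem_filtration (MulSemiringAction.toRingHom G M σ) hτ.2) hσ.2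
  convert h using 1
  rw [wittAct_mul, map_sub, map_sub, map_intCast]
  push_cast
  ring

theorem one : IsTranslation n H α 1 0 :=
  ⟨H.one_mem, by simpa only [wittAct_one, sub_self, Int.cast_zero] using zero_mem _⟩

theorem inv (hσ : IsTranslation n H α σ m) : IsTranslation n H α σ⁻¹ (-m) := by
  refine ⟨H.inv_mem hσ.1, ?_⟩
  have h := (filtration p M n).neg_mem
    (map_mem_filtration (MulSemiringAction.toRingHom G M σ⁻¹) hσ.2)
  convert h using 1
  rw [map_sub, map_sub, map_intCast, ← wittAct_mul, inv_mul_cancel, wittAct_one]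
  push_cast
  ring

theorem pow (hσ : IsTranslation n H α σ m) (j : ℕ) : IsTranslation n H α (σ ^ j) (j * m) := by
  induction j with
  | zero => simpa using one
  | succ j ih =>
    have := ih.mul hσ
    rw [← pow_succ] at this
    convert this using 1
    push_cast
    ring

variable [CharP M p]

theorem one_of_dvd (h : (p : ℤ) ^ n ∣ m) : IsTranslation n H α 1 m := by
  refine ⟨H.one_mem, ?_⟩
  rw [wittAct_one, sub_self, zero_sub]
  exact neg_mem (intCast_mem_filtration.2 h)

theorem dvd_sub (hm : IsTranslation n H α σ m) (hl : IsTranslation n H α σ l) :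
    (p : ℤ) ^ n ∣ m - l := by
  rw [← intCast_mem_filtration (R := M)]
  convert sub_mem hl.2 hm.2 using 1
  push_cast
  ring

theorem of_dvd_sub (hm : IsTranslation n H α σ m) (h : (p : ℤ) ^ n ∣ l - m) :
    IsTranslation n H α σ l := by
  simpa using hm.mul (one_of_dvd h)

theorem exists_int {a : WittVector p M} (hα : frobenius α - α - a ∈ filtration p M n)
    (ha : wittAct p σ a - a ∈ filtration p M n) (hσ : σ ∈ H) :
    ∃ m, IsTranslation n H α σ m := by
  have : frobenius (wittAct p σ α - α) - (wittAct p σ α - α) ∈ filtration p M n := by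
    convert add_mem (sub_mem
      (map_mem_filtration (MulSemiringAction.toRingHom G M σ) hα) hα) ha using 1
    rw [map_sub, map_sub, map_sub, frobenius_map]
    ring
  obtain ⟨m, hm⟩ := exists_intCast_of_frobenius_sub_mem this
  exact ⟨m, hσ, hm⟩

end IsTranslation

namespace IsSplit

variable {n : ℕ} {H : Subgroup G} {α β : WittVector p M} {b c : M}

theorem mono (h : IsSplit n H α b)
    (hβ : ∀ σ m, IsTranslation n H β σ m → IsTranslation n H α σ m) : IsSplit n H β b := by
  obtain ⟨v, S, hS, hv0, hv, hb, hvS⟩ := h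
  exact ⟨v, S, hS, hv0, fun σ m τ l hσ hτ => hv σ m τ l (hβ _ _ hσ) (hβ _ _ hτ), hb,
    fun σ hσ => hvS σ (hβ _ _ hσ)⟩

theorem mul (hb : IsSplit n H α b) (hc : IsSplit n H α c) : IsSplit n H α (b * c) := by
  obtain ⟨v, S, hS, hv0, hv, rfl, hvS⟩ := hb
  obtain ⟨w, T, hT, hw0, hw, rfl, hwT⟩ := hc
  refine ⟨fun σ m => v σ m * w σ m, S ∪ T, hS.union hT, fun σ m => mul_ne_zero (hv0 _ _) (hw0 _ _),
    fun σ m τ l hσ hτ => ?_, rfl, fun σ hσ h => ?_⟩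
  · simp only [hv σ m τ l hσ hτ, hw σ m τ l hσ hτ, smul_mul']
    ring
  · simp only [hvS σ hσ fun s hs => h s (.inl hs), hwT σ hσ fun s hs => h s (.inr hs), mul_one]

theorem zpow (hb : IsSplit n H α b) (j : ℤ) : IsSplit n H α (b ^ j) := by
  obtain ⟨v, S, hS, hv0, hv, rfl, hvS⟩ := hb
  refine ⟨fun σ m => v σ m ^ j, S, hS, fun σ m => zpow_ne_zero _ (hv0 _ _),
    fun σ m τ l hσ hτ => ?_, rfl, fun σ hσ h => ?_⟩
  · have : σ • (v τ l ^ j) = (σ • v τ l) ^ j :=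
      map_zpow₀ (MulSemiringAction.toRingHom G M σ) _ _
    simp only [hv σ m τ l hσ hτ, mul_zpow, this]
  · simp only [hvS σ hσ h, one_zpow]

theorem pow_prime_pow {d : M} (hd0 : d ≠ 0) (hd : ∀ σ ∈ H, σ • d = d) :
    IsSplit n H α (d ^ p ^ n) := by
  refine ⟨fun _ m => d ^ m, ∅, Set.finite_empty, fun σ m => zpow_ne_zero _ hd0,
    fun σ m τ l hσ _ => ?_, zpow_natCast _ _, fun _ _ _ => zpow_zero _⟩
  have : σ • (d ^ l) = (σ • d) ^ l := map_zpow₀ (MulSemiringAction.toRingHom G M σ) _ _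
  beta_reduce
  rw [this, hd σ hσ.1, zpow_add₀ hd0]

theorem one : IsSplit n H α 1 := by
  simpa using pow_prime_pow (n := n) (H := H) (α := α) one_ne_zero (fun σ _ => smul_one σ)

theorem prod {ι : Type*} (s : Finset ι) {f : ι → M} (h : ∀ i ∈ s, IsSplit n H α (f i)) :
    IsSplit n H α (∏ i ∈ s, f i) := by
  classical
  induction s using Finset.induction_on with
  | empty => simpa using one
  | insert i s hi ih =>
    rw [Finset.prod_insert hi]
    exact (h i (Finset.mem_insert_self _ _)).mul
      (ih fun j hj => h j (Finset.mem_insert_of_mem hj))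

theorem of_pow_of_coprime (hb0 : b ≠ 0) (hb : ∀ σ ∈ H, σ • b = b) {j : ℕ}
    (hj : j.Coprime p) (h : IsSplit n H α (b ^ j)) : IsSplit n H α b := by
  have hco : IsCoprime (j : ℤ) ((p ^ n : ℕ) : ℤ) :=
    Nat.isCoprime_iff_coprime.2 (hj.pow_right n)
  obtain ⟨x, y, hxy⟩ := hco
  have := (h.zpow x).mul ((pow_prime_pow (n := n) (α := α) hb0 hb).zpow y)
  convert this using 1
  rw [← zpow_natCast, ← zpow_natCast, ← zpow_mul, ← zpow_mul, ← zpow_add₀ hb0,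
    mul_comm _ x, mul_comm _ y, hxy, zpow_one]

/-- Corestriction (transfer) from a subgroup `H'` of `H` on which all translations are divisible
by `p`. -/
theorem prod_pow_smul {H' : Subgroup G} (hH' : ∀ σ m, IsTranslation (n + 1) H α σ m → (p : ℤ) ∣ m →
    σ ∈ H') {g : G} (hg : IsTranslation (n + 1) H α g 1) {y : M} (h : IsSplit (n + 1) H' α y) :
    IsSplit (n + 1) H α (∏ j : ZMod p, g ^ j.val • y) := by
  obtain ⟨v, S, hS, hv0, hv, rfl, hvS⟩ := h
  have conj {σ : G} {m : ℤ} (hσ : IsTranslation (n + 1) H α σ m) (j : ZMod p) :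
      IsTranslation (n + 1) H' α ((g ^ (m + j : ZMod p).val)⁻¹ * σ * g ^ j.val)
        (m + j.val - (m + j : ZMod p).val) := by
    have h1 := ((hg.pow (m + j : ZMod p).val).inv.mul hσ).mul (hg.pow j.val)
    rw [show -(((m + j : ZMod p).val : ℤ) * 1) + m + (j.val : ℤ) * 1
      = m + j.val - (m + j : ZMod p).val by ring] at h1
    refine ⟨hH' _ _ h1 ?_, h1.2⟩
    rw [← ZMod.intCast_zmod_eq_zero_iff_dvd]
    simp
  refine ⟨fun σ m => ∏ j : ZMod p, g ^ (m + j : ZMod p).val •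
      v ((g ^ (m + j : ZMod p).val)⁻¹ * σ * g ^ j.val) (m + j.val - (m + j : ZMod p).val),
    ⋃ j : ZMod p, (fun s => g ^ j.val • s) '' S, Set.finite_iUnion fun j => hS.image _,
    fun σ m => Finset.prod_ne_zero_iff.2 fun j _ => (smul_ne_zero_iff_ne _).2 (hv0 _ _),
    fun σ m τ l hσ hτ => ?_, ?_, fun σ hσ h => ?_⟩
  · beta_reduce
    rw [← Equiv.prod_comp (Equiv.addLeft (l : ZMod p)) (fun j : ZMod p =>
      g ^ (m + j : ZMod p).val • v ((g ^ (m + j : ZMod p).val)⁻¹ * σ * g ^ j.val)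
        (m + j.val - (m + j : ZMod p).val)), Finset.smul_prod', ← Finset.prod_mul_distrib]
    refine Finset.prod_congr rfl fun j _ => ?_
    have := hv _ _ _ _ (conj hσ (l + j)) (conj hτ j)
    rw [← add_assoc] at this
    rw [Equiv.coe_addLeft, ← add_assoc, Int.cast_add]
    rw [show (g ^ (m + l + j : ZMod p).val)⁻¹ * σ * g ^ (l + j : ZMod p).val *
        ((g ^ (l + j : ZMod p).val)⁻¹ * τ * g ^ j.val) =
        (g ^ (m + l + j : ZMod p).val)⁻¹ * (σ * τ) * g ^ j.val by group,
      show m + ((l + j : ZMod p).val : ℤ) - ((m + l + j : ZMod p).val : ℤ) +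
        (l + j.val - ((l + j : ZMod p).val : ℤ)) =
        m + l + j.val - ((m + l + j : ZMod p).val : ℤ) by ring] at this
    rw [this, smul_mul', smul_smul, smul_smul]
    congr 2
    group
  · refine Finset.prod_congr rfl fun j _ => ?_
    have h0 : (((p ^ (n + 1) : ℕ) : ℤ) : ZMod p) = 0 := by simp [pow_succ]
    rw [h0, zero_add, mul_one, inv_mul_cancel, add_sub_cancel_right]
  · refine Finset.prod_eq_one fun j _ => ?_
    have := conj hσ j
    simp only [Int.cast_zero, zero_add, sub_self] at this ⊢
    rw [hvS _ this, smul_one]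
    intro s hs
    rw [mul_smul, mul_smul, h _ (Set.mem_iUnion.2 ⟨j, s, hs, rfl⟩), inv_smul_smul]

variable [CharP M p]

theorem add (hb : ∀ σ ∈ H, σ • b = b) (hα : IsSplit n H α b) (hβ : IsSplit n H β b)
    (hex : ∀ σ ∈ H, ∃ m, IsTranslation n H α σ m) : IsSplit n H (α + β) b := by
  classical
  obtain ⟨v, S, hS, hv0, hv, hvb, hvS⟩ := hα
  obtain ⟨w, T, hT, hw0, hw, hwb, hwT⟩ := hβ
  have hb0 : b ≠ 0 := hvb ▸ hv0 _ _
  choose! t ht using hex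
  have periodic {γ : WittVector p M} {u : G → ℤ → M}
      (hu : ∀ σ m τ l, IsTranslation n H γ σ m → IsTranslation n H γ τ l →
        u (σ * τ) (m + l) = u σ m * σ • u τ l)
      (hub : u 1 (p ^ n : ℕ) = b) {σ : G} {m : ℤ} (hσ : IsTranslation n H γ σ m) (j : ℤ) :
      u σ (m + p ^ n * j) = u σ m * b ^ j := by
    have hb1 {σ : G} {m : ℤ} (hσ : IsTranslation n H γ σ m) :
        u σ (m + p ^ n) = u σ m * b := by
      have := hu σ m 1 (p ^ n : ℕ) hσ (.one_of_dvd (by simp))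
      rwa [mul_one, hub, hb σ hσ.1, Nat.cast_pow] at this
    induction j using Int.induction_on with
    | zero => simp
    | succ j ih =>
      rw [mul_add, mul_one, ← add_assoc, hb1 (hσ.of_dvd_sub (by simp)), ih, zpow_add₀ hb0,
        zpow_one, mul_assoc]
    | pred j ih =>
      have := hb1 (σ := σ) (m := m + p ^ n * (-j - 1)) (hσ.of_dvd_sub (by simp))
      rw [show m + (p : ℤ) ^ n * (-j - 1) + p ^ n = m + p ^ n * (-j) by ring, ih] at this
      rw [zpow_sub₀ hb0, zpow_one, ← mul_div_assoc, this, mul_div_cancel_right₀ _ hb0]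
  have hsub {σ : G} {m l : ℤ} (h : IsTranslation n H (α + β) σ m)
      (hl : IsTranslation n H α σ l) : IsTranslation n H β σ (m - l) := by
    refine ⟨h.1, ?_⟩
    convert sub_mem h.2 hl.2 using 1
    rw [map_add]
    push_cast
    ring
  have indep {σ : G} {m l : ℤ} (h : IsTranslation n H (α + β) σ m)
      (hl : IsTranslation n H α σ l) :
      v σ (t σ) * w σ (m - t σ) = v σ l * w σ (m - l) := by
    obtain ⟨j, hj⟩ := hl.dvd_sub (ht σ h.1)
    have hl' : l = t σ + p ^ n * j := by rw [← hj]; ring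
    have hm : m - t σ = (m - l) + p ^ n * j := by rw [hl']; ring
    rw [hm, periodic hw hwb (hsub h hl), ← mul_assoc, mul_right_comm, ← periodic hv hvb (ht σ h.1),
      ← hl']
  refine ⟨fun σ m => v σ (t σ) * w σ (m - t σ),
    S ∪ T ∪ (fun i => α.coeff i) '' Set.Iio n, (hS.union hT).union ((Set.finite_Iio n).image _),
    fun σ m => mul_ne_zero (hv0 _ _) (hw0 _ _), fun σ m τ l hσ hτ => ?_, ?_, fun σ hσ h => ?_⟩
  · have h1 := ht σ hσ.1
    have h2 := ht τ hτ.1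
    beta_reduce
    rw [indep (hσ.mul hτ) (h1.mul h2), hv _ _ _ _ h1 h2, add_sub_add_comm,
      hw _ _ _ _ (hsub hσ h1) (hsub hτ h2), smul_mul']
    ring
  · beta_reduce
    rw [indep (.one_of_dvd (by simp)) .one, sub_zero, hwb]
    have := hv 1 0 1 0 .one .one
    rw [mul_one, add_zero, one_smul, left_eq_mul₀ (hv0 _ _)] at this
    rw [this, one_mul]
  · have hσα : IsTranslation n H α σ 0 := by
      refine ⟨hσ.1, ?_⟩
      rw [Int.cast_zero, sub_zero, mem_filtration_sub_iff]
      exact fun i hi => h _ (.inr ⟨i, hi, rfl⟩)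
    beta_reduce
    rw [indep hσ hσα, sub_zero, hvS σ hσα fun s hs => h s (.inl (.inl hs)),
      hwT σ ?_ fun s hs => h s (.inl (.inr hs)), mul_one]
    simpa using hsub hσ hσα

theorem succ_of_eq_add_verschiebung {γ c : WittVector p M} (hα : α = c + verschiebung γ)
    (hc : ∀ σ ∈ H, wittAct p σ c = c) (h : IsSplit n H γ b) : IsSplit (n + 1) H α b := by
  have key {σ : G} {m : ℤ} (hσ : IsTranslation (n + 1) H α σ m) :
      (p : ℤ) ∣ m ∧ IsTranslation n H γ σ (m / p) := by
    have h1 : wittAct p σ α - α = verschiebung (wittAct p σ γ - γ) := by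
      rw [hα, map_add, hc σ hσ.1, map_sub, map_verschiebung]
      ring
    have h2 := hσ.2
    rw [h1] at h2
    have h0 := coeff_zero_of_mem_filtration_succ h2
    rw [sub_coeff_zero, verschiebung_coeff_zero, intCast_coeff_zero, zero_sub, neg_eq_zero,
      CharP.intCast_eq_zero_iff M p] at h0
    obtain ⟨l, rfl⟩ := h0
    rw [← verschiebung_intCast, ← map_sub, verschiebung_mem_filtration_succ] at h2
    rw [Int.mul_ediv_cancel_left _ (by exact_mod_cast (Fact.out (p := p.Prime)).ne_zero)]
    exact ⟨dvd_mul_right _ _, hσ.1, h2⟩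
  obtain ⟨v, S, hS, hv0, hv, hb, hvS⟩ := h
  refine ⟨fun σ m => v σ (m / p), S, hS, fun σ m => hv0 _ _, fun σ m τ l hσ hτ => ?_, ?_,
    fun σ hσ hs => ?_⟩
  · beta_reduce
    rw [Int.add_ediv_of_dvd_left (key hσ).1]
    exact hv _ _ _ _ (key hσ).2 (key hτ).2
  · beta_reduce
    rw [← hb, pow_succ, Nat.cast_mul,
      Int.mul_ediv_cancel _ (by exact_mod_cast (Fact.out (p := p.Prime)).ne_zero)]
  · have := (key hσ).2
    rw [Int.zero_ediv] at this
    simpa using hvS σ this hs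

end IsSplit

end Cocycles

section Vanishing

open WittVector
open scoped Polynomial

variable {p : ℕ} [Fact p.Prime] {G M k : Type*} [Group G] [Field M] [MulSemiringAction G M]
  [Field k] [Algebra k M]

theorem wittAct_map_aeval (hk : ∀ (σ : G) (c : k), σ • algebraMap k M c = algebraMap k M c)
    {σ : G} {b : M} (hb : σ • b = b) (a : WittVector p k[X]) :
    wittAct p σ (map (Polynomial.aeval b : k[X] →ₐ[k] M).toRingHom a) =
      map (Polynomial.aeval b : k[X] →ₐ[k] M).toRingHom a := by
  ext i
  simp only [map_coeff, AlgHom.toRingHom_eq_coe, RingHom.coe_coe]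
  generalize a.coeff i = P
  rw [MulSemiringAction.toRingHom_apply]
  induction P using Polynomial.induction_on' with
  | add P Q hP hQ => rw [map_add, smul_add, hP, hQ]
  | monomial i c => rw [Polynomial.aeval_monomial, smul_mul', smul_pow', hk, hb]

/-- The inductive hypothesis of the vanishing theorem, at length `n`: the symbol of `b` with any
Witt vector whose coefficients are polynomials in `b` without constant term is trivial. -/
def PolynomialSymbolsVanish (p n : ℕ) [Fact p.Prime] (G k M : Type*) [Group G] [Field M]
    [MulSemiringAction G M] [Field k] [Algebra k M] : Prop :=
  ∀ (H : Subgroup G) (b : M), b ≠ 0 → (∀ σ ∈ H, σ • b = b) →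
    ∀ a : WittVector p k[X], map (Polynomial.evalRingHom 0) a = 0 → ∀ α : WittVector p M,
      frobenius α - α - map (Polynomial.aeval b : k[X] →ₐ[k] M).toRingHom a ∈ filtration p M n →
        IsSplit n H α b

variable [CharP M p] {n : ℕ} {H : Subgroup G} {α : WittVector p M} {b x : M}

theorem PolynomialSymbolsVanish.isSplit_coeff_zero (ih : PolynomialSymbolsVanish p n G k M)
    (hα0 : α.coeff 0 ≠ 0) (hH : ∀ σ ∈ H, σ • α.coeff 0 = α.coeff 0)
    (hα : frobenius α - α - teichmuller p x ∈ filtration p M (n + 1)) :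
    IsSplit (n + 1) H α (α.coeff 0) := by
  have hx := coeff_zero_of_mem_filtration_succ hα
  rw [sub_coeff_zero, sub_coeff_zero, coeff_frobenius_charP, teichmuller_coeff_zero] at hx
  obtain ⟨γ, hγ⟩ := exists_eq_teichmuller_add_verschiebung α
  set y := α.coeff 0
  obtain ⟨g, hg⟩ := exists_eq_verschiebung (p := p) (R := k[X])
    (x := teichmuller p (Polynomial.X ^ p - Polynomial.X) - teichmuller p (Polynomial.X ^ p) +
      teichmuller p Polynomial.X)
    (by rw [add_coeff_zero, sub_coeff_zero, teichmuller_coeff_zero, teichmuller_coeff_zero,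
      teichmuller_coeff_zero]; ring)
  have hp0 : p ≠ 0 := (Fact.out (p := p.Prime)).ne_zero
  have hg0 : map (Polynomial.evalRingHom 0) g = 0 := by
    apply verschiebung_injective p k
    rw [← map_verschiebung, ← hg]
    simp [map_teichmuller, hp0]
  have hgy := congrArg (map (Polynomial.aeval y : k[X] →ₐ[k] M).toRingHom) hg
  rw [map_verschiebung] at hgy
  simp only [map_add, map_sub, map_teichmuller, AlgHom.toRingHom_eq_coe, RingHom.coe_coe,
    map_pow, Polynomial.aeval_X] at hgy
  refine IsSplit.succ_of_eq_add_verschiebung hγ (fun σ hσ => ?_)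
    (ih H y hα0 hH g hg0 γ ?_)
  · rw [map_teichmuller, MulSemiringAction.toRingHom_apply, hH σ hσ]
  · rw [← verschiebung_mem_filtration_succ]
    convert hα using 1
    simp only [map_sub, AlgHom.toRingHom_eq_coe]
    rw [← hgy, hγ, map_add, verschiebung_frobenius_comm, frobenius_teichmuller,
      show x = y ^ p - y by linear_combination -hx, map_pow]
    ring

theorem PolynomialSymbolsVanish.isSplit_teichmuller (ih : PolynomialSymbolsVanish p n G k M)
    (hx0 : x ≠ 0) (hx : ∀ σ ∈ H, σ • x = x)
    (hα : frobenius α - α - teichmuller p x ∈ filtration p M (n + 1)) :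
    IsSplit (n + 1) H α x := by
  have hαx := coeff_zero_of_mem_filtration_succ hα
  rw [sub_coeff_zero, sub_coeff_zero, coeff_frobenius_charP, teichmuller_coeff_zero] at hαx
  have hprod := prod_add_zmod_val (p := p) (α.coeff 0)
  rw [sub_eq_zero.1 hαx] at hprod
  have htrans {σ : G} {m : ℤ} (hσ : IsTranslation (n + 1) H α σ m) :
      σ • α.coeff 0 = α.coeff 0 + m := by
    have := coeff_zero_of_mem_filtration_succ hσ.2
    rw [sub_coeff_zero, sub_coeff_zero, intCast_coeff_zero, map_coeff,
      MulSemiringAction.toRingHom_apply] at this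
    linear_combination this
  by_cases hH : ∀ σ ∈ H, σ • α.coeff 0 = α.coeff 0
  · rw [← hprod]
    refine IsSplit.prod _ fun j _ => ?_
    have hj0 : α.coeff 0 + (j.val : M) ≠ 0 :=
      Finset.prod_ne_zero_iff.1 (hprod.trans_ne hx0) j (Finset.mem_univ _)
    have hcoeff : (α + ((j.val : ℤ) : WittVector p M)).coeff 0 = α.coeff 0 + (j.val : M) := by
      rw [add_coeff_zero, intCast_coeff_zero, Int.cast_natCast]
    have := ih.isSplit_coeff_zero (H := H) (α := α + ((j.val : ℤ) : WittVector p M)) (x := x)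
      (by rwa [hcoeff]) (fun σ hσ => ?_) ?_
    · rw [hcoeff] at this
      refine this.mono fun σ m hσ => ⟨hσ.1, ?_⟩
      convert hσ.2 using 1
      rw [map_add, map_intCast]
      ring
    · rw [hcoeff, smul_add, hH σ hσ]
      congr 1
      exact map_natCast (MulSemiringAction.toRingHom G M σ) _
    · convert hα using 1
      rw [map_add, map_intCast]
      ring
  · push Not at hH
    obtain ⟨σ, hσ, hσy⟩ := hH
    obtain ⟨m, hm⟩ := IsTranslation.exists_int hα (H := H) (σ := σ)
      (by rw [map_teichmuller, MulSemiringAction.toRingHom_apply, hx σ hσ, sub_self]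
          exact zero_mem _) hσ
    have hpm : ¬ (p : ℤ) ∣ m := fun h => hσy <| by
      rw [htrans hm, (CharP.intCast_eq_zero_iff M p m).2 h, add_zero]
    obtain ⟨g, hg⟩ : ∃ g, IsTranslation (n + 1) H α g 1 := by
      have hp := Nat.prime_iff_prime_int.1 (Fact.out (p := p.Prime))
      obtain ⟨u, hu⟩ : ∃ u : ℕ, (p : ℤ) ^ (n + 1) ∣ 1 - u * m := by
        obtain ⟨u, w, huw⟩ :=
          (((Prime.coprime_iff_not_dvd hp).2 hpm).symm.pow_right (n := n + 1))
        have hpos : (0 : ℤ) < p ^ (n + 1) :=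
          pow_pos (by exact_mod_cast (Fact.out (p := p.Prime)).pos) _
        refine ⟨(u % (p : ℤ) ^ (n + 1)).toNat, ?_⟩
        rw [Int.toNat_of_nonneg (Int.emod_nonneg _ hpos.ne')]
        refine ⟨w + (u / p ^ (n + 1)) * m, ?_⟩
        have := Int.emod_add_mul_ediv u (p ^ (n + 1))
        linear_combination -huw - m * this
      exact ⟨_, (hm.pow u).of_dvd_sub hu⟩
    have hsplit : IsSplit (n + 1) (H ⊓ MulAction.stabilizer G (α.coeff 0)) α (α.coeff 0) := by
      refine ih.isSplit_coeff_zero (fun h0 => hσy ?_) (fun τ hτ => (Subgroup.mem_inf.1 hτ).2) hα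
      rw [h0, smul_zero]
    have := hsplit.prod_pow_smul (H := H) (fun τ l hτ hl => Subgroup.mem_inf.2 ⟨hτ.1, ?_⟩) hg
    · rw [← hprod]
      convert this using 1
      refine Finset.prod_congr rfl fun j _ => ?_
      rw [htrans (hg.pow j.val)]
      simp
    · rw [MulAction.mem_stabilizer_iff, htrans hτ, (CharP.intCast_eq_zero_iff M p l).2 hl,
        add_zero]

theorem PolynomialSymbolsVanish.isSplit_verschiebung (ih : PolynomialSymbolsVanish p n G k M)
    (hb0 : b ≠ 0) (hb : ∀ σ ∈ H, σ • b = b) {a : WittVector p k[X]}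
    (ha : map (Polynomial.evalRingHom 0) a = 0)
    (hα : frobenius α - α - verschiebung (map (Polynomial.aeval b : k[X] →ₐ[k] M).toRingHom a) ∈
      filtration p M (n + 1)) :
    IsSplit (n + 1) H α b := by
  have h0 := coeff_zero_of_mem_filtration_succ hα
  rw [sub_coeff_zero, sub_coeff_zero, coeff_frobenius_charP, verschiebung_coeff_zero, sub_zero,
    sub_eq_zero] at h0
  obtain ⟨j, hj⟩ := exists_intCast_eq_of_pow_eq_self h0
  obtain ⟨γ, hγ⟩ := exists_eq_verschiebung (x := α - (j : WittVector p M))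
    (by rw [sub_coeff_zero, intCast_coeff_zero, hj, sub_self])
  refine IsSplit.succ_of_eq_add_verschiebung (c := j) (by rw [← hγ]; ring)
    (fun σ _ => map_intCast _ _) (ih H b hb0 hb a ha γ ?_)
  rw [← verschiebung_mem_filtration_succ]
  convert hα using 1
  rw [map_sub, map_sub, verschiebung_frobenius_comm, ← hγ, map_sub, map_intCast]
  ring

theorem PolynomialSymbolsVanish.isSplit_teichmuller_monomial [CharP k p] [PerfectRing k p]
    (ih : PolynomialSymbolsVanish p n G k M)
    (hk : ∀ (σ : G) (c : k), σ • algebraMap k M c = algebraMap k M c)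
    (hb0 : b ≠ 0) (hb : ∀ σ ∈ H, σ • b = b) {c : k} (hc : c ≠ 0) {m : ℕ} (hm : m ≠ 0)
    (hα : frobenius α - α - teichmuller p (algebraMap k M c * b ^ m) ∈ filtration p M (n + 1)) :
    IsSplit (n + 1) H α b := by
  induction m using Nat.strong_induction_on generalizing c α with
  | _ m ihm =>
  have hfix (c : k) (m : ℕ) {σ : G} (hσ : σ ∈ H) :
      σ • (algebraMap k M c * b ^ m) = algebraMap k M c * b ^ m := by
    rw [smul_mul', smul_pow', hk, hb σ hσ]
  have hp := Fact.out (p := p.Prime)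
  by_cases hpm : p ∣ m
  · obtain ⟨l, rfl⟩ := hpm
    have hl : l ≠ 0 := right_ne_zero_of_mul hm
    obtain ⟨d, hdc⟩ := (PerfectRing.bijective_frobenius (R := k) (p := p)).2 c
    change d ^ p = c at hdc
    subst hdc
    have hd : d ≠ 0 := fun h => hc (by rw [h, zero_pow hp.ne_zero])
    set z := teichmuller p (algebraMap k M d * b ^ l)
    refine (ihm l (by nlinarith [hp.two_le, hl.bot_lt]) (α := α - z) hd hl ?_).mono
      fun σ m hσ => ⟨hσ.1, ?_⟩
    · convert hα using 1
      rw [map_sub, frobenius_teichmuller, mul_pow, map_pow (algebraMap k M), mul_comm p l, pow_mul]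
      ring
    · convert hσ.2 using 1
      rw [map_sub, map_teichmuller, MulSemiringAction.toRingHom_apply, hfix d l hσ.1]
      ring
  · have hcM : algebraMap k M c ≠ 0 := (_root_.map_ne_zero _).2 hc
    have h1 := ih.isSplit_teichmuller (mul_ne_zero hcM (pow_ne_zero m hb0))
      (fun σ hσ => hfix c m hσ) hα
    obtain ⟨d, hd⟩ : ∃ d : k, d ^ p ^ (n + 1) = c := by
      obtain ⟨d, hd⟩ := (bijective_iterateFrobenius (R := k) p (n + 1)).2 c
      exact ⟨d, by rw [← hd, iterateFrobenius_def]⟩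
    have hd0 : d ≠ 0 := by
      rintro rfl
      exact hc (by rw [← hd, zero_pow (pow_ne_zero _ hp.ne_zero)])
    have h2 := IsSplit.pow_prime_pow (n := n + 1) (H := H) (α := α)
      (d := algebraMap k M d) ((_root_.map_ne_zero _).2 hd0) fun σ _ => hk σ d
    rw [← map_pow, hd] at h2
    have h3 := h1.mul (h2.zpow (-1))
    rw [mul_right_comm, zpow_neg_one, mul_inv_cancel₀ hcM, one_mul] at h3
    exact h3.of_pow_of_coprime hb0 hb ((Nat.coprime_comm.1 (hp.coprime_iff_not_dvd.2 hpm)))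

theorem IsSplit.of_frobenius_sub_add [IsSepClosed M] (hb : ∀ σ ∈ H, σ • b = b)
    {a₁ a₂ : WittVector p M} (ha₁ : ∀ σ ∈ H, wittAct p σ a₁ = a₁)
    (h₁ : ∀ β, frobenius β - β - a₁ ∈ filtration p M n → IsSplit n H β b)
    (h₂ : ∀ β, frobenius β - β - a₂ ∈ filtration p M n → IsSplit n H β b)
    (hα : frobenius α - α - (a₁ + a₂) ∈ filtration p M n) : IsSplit n H α b := by
  obtain ⟨β, hβ⟩ := exists_frobenius_sub_sub_mem n a₁
  have := (h₁ β hβ).add hb (h₂ (α - β) ?_) fun σ hσ => IsTranslation.exists_int hβ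
    (by rw [ha₁ σ hσ, sub_self]; exact zero_mem _) hσ
  · rwa [add_sub_cancel] at this
  · convert sub_mem hα hβ using 1
    rw [map_sub]
    ring

theorem polynomialSymbolsVanish [CharP k p] [PerfectRing k p] [IsSepClosed M]
    (hk : ∀ (σ : G) (c : k), σ • algebraMap k M c = algebraMap k M c) (n : ℕ) :
    PolynomialSymbolsVanish p n G k M := by
  induction n with
  | zero =>
    intro H b hb0 hb a _ α _
    simpa using IsSplit.pow_prime_pow (n := 0) (H := H) (α := α) hb0 hb
  | succ n ih =>
    intro H b hb0 hb a ha α hα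
    set f := (Polynomial.aeval b : k[X] →ₐ[k] M).toRingHom with hf
    have hfix (a : WittVector p k[X]) : ∀ σ ∈ H, wittAct p σ (map f a) = map f a :=
      fun σ hσ => wittAct_map_aeval hk (hb σ hσ) a
    have hpoly (P : k[X]) : ∀ β : WittVector p M,
        frobenius β - β - map f (teichmuller p (P * Polynomial.X)) ∈ filtration p M (n + 1) →
          IsSplit (n + 1) H β b := by
      induction P using Polynomial.induction_on' with
      | add P Q hP hQ =>
        intro β hβ
        obtain ⟨g, hg⟩ := exists_teichmuller_add (p := p) (P * Polynomial.X) (Q * Polynomial.X)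
        rw [add_mul, hg, map_add] at hβ
        refine IsSplit.of_frobenius_sub_add hb (hfix _) (fun γ hγ => ?_) (fun γ hγ => ?_) hβ
        · rw [map_add] at hγ
          exact IsSplit.of_frobenius_sub_add hb (hfix _) hP hQ hγ
        · rw [map_verschiebung] at hγ
          refine ih.isSplit_verschiebung hb0 hb ?_ hγ
          apply verschiebung_injective p k
          have := congrArg (map (Polynomial.evalRingHom 0)) hg
          simpa [map_teichmuller, ← map_verschiebung, eq_comm] using this
      | monomial m c =>
        intro β hβ
        rcases eq_or_ne c 0 with rfl | hc
        · refine ih.isSplit_verschiebung hb0 hb (a := 0) (map_zero _) ?_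
          simpa using hβ
        · refine ih.isSplit_teichmuller_monomial hk hb0 hb hc m.succ_ne_zero ?_
          rw [map_teichmuller, Polynomial.monomial_mul_X] at hβ
          simpa [hf, Polynomial.aeval_monomial] using hβ
    obtain ⟨a', ha'⟩ := exists_eq_teichmuller_add_verschiebung a
    have ha0 : (a.coeff 0).eval 0 = 0 := by
      simpa [map_coeff] using congrArg (coeff · 0) ha
    obtain ⟨P, hP⟩ := Polynomial.X_dvd_iff.2 ((Polynomial.coeff_zero_eq_eval_zero _).trans ha0)
    rw [mul_comm] at hP
    rw [ha', map_add] at hα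
    refine IsSplit.of_frobenius_sub_add hb (hfix _) (fun β hβ => hpoly P β (hP ▸ hβ))
      (fun β hβ => ?_) hα
    rw [map_verschiebung] at hβ
    refine ih.isSplit_verschiebung hb0 hb ?_ hβ
    apply verschiebung_injective p k
    rw [← map_verschiebung, map_zero]
    rw [ha', map_add, map_teichmuller] at ha
    simpa [ha0] using ha

end Vanishing

section Norm

open WittVector

variable {K M : Type*} [Field K] [Field M] [Algebra K M]

/-- Hilbert 90 for a continuous `1`-cocycle on a subgroup of a Galois group. -/
theorem exists_mul_apply_eq_of_cocycle [Algebra.IsAlgebraic K M] {N : Subgroup Gal(M/K)}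
    {w : Gal(M/K) → M} {S : Set M} (hS : S.Finite) (hw0 : ∀ σ, w σ ≠ 0)
    (hw : ∀ σ ∈ N, ∀ τ ∈ N, w (σ * τ) = w σ * σ (w τ))
    (hwS : ∀ σ ∈ N, (∀ s ∈ S, σ s = s) → w σ = 1) :
    ∃ z : M, z ≠ 0 ∧ ∀ σ ∈ N, w σ * σ z = z := by
  classical
  have : Finite S := hS
  set E := IntermediateField.adjoin K S
  have : FiniteDimensional K E :=
    IntermediateField.finiteDimensional_adjoin fun x _ => Algebra.IsIntegral.isIntegral x
  have hindep {σ τ : Gal(M/K)} (hσ : σ ∈ N) (hτ : τ ∈ N)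
      (h : σ.toAlgHom.comp E.val = τ.toAlgHom.comp E.val) : w σ = w τ := by
    have h1 : w (σ⁻¹ * τ) = 1 := by
      refine hwS _ (N.mul_mem (N.inv_mem hσ) hτ) fun s hs => ?_
      have := DFunLike.congr_fun h ⟨s, IntermediateField.subset_adjoin K S hs⟩
      change σ s = τ s at this
      rw [AlgEquiv.mul_apply, ← this, ← AlgEquiv.mul_apply, inv_mul_cancel, AlgEquiv.one_apply]
    have := hw σ hσ _ (N.mul_mem (N.inv_mem hσ) hτ)
    rw [mul_inv_cancel_left, h1, map_one, mul_one] at this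
    exact this.symm
  let c (φ : E →ₐ[K] M) : M :=
    if h : ∃ σ ∈ N, σ.toAlgHom.comp E.val = φ then w h.choose else 0
  have hc {σ : Gal(M/K)} (hσ : σ ∈ N) : c (σ.toAlgHom.comp E.val) = w σ := by
    have h : ∃ τ ∈ N, τ.toAlgHom.comp E.val = σ.toAlgHom.comp E.val := ⟨σ, hσ, rfl⟩
    simp only [c, dif_pos h]
    exact hindep h.choose_spec.1 hσ h.choose_spec.2
  have hcomp {σ : Gal(M/K)} (hσ : σ ∈ N) (φ : E →ₐ[K] M) :
      c (σ.toAlgHom.comp φ) = w σ * σ (c φ) := by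
    by_cases h : ∃ τ ∈ N, τ.toAlgHom.comp E.val = φ
    · obtain ⟨τ, hτ, rfl⟩ := h
      rw [hc hτ, ← hw σ hσ τ hτ]
      exact hc (N.mul_mem hσ hτ)
    · have h' : ¬ ∃ τ ∈ N, τ.toAlgHom.comp E.val = σ.toAlgHom.comp φ := by
        rintro ⟨τ, hτ, hτφ⟩
        refine h ⟨σ⁻¹ * τ, N.mul_mem (N.inv_mem hσ) hτ, AlgHom.ext fun x => ?_⟩
        have := DFunLike.congr_fun hτφ x
        change τ x = σ (φ x) at this
        change σ⁻¹ (τ x) = φ x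
        rw [this, ← AlgEquiv.mul_apply, inv_mul_cancel, AlgEquiv.one_apply]
      simp only [c, dif_neg h, dif_neg h', map_zero, mul_zero]
  obtain ⟨x, hx⟩ : ∃ x : E, ∑ φ : E →ₐ[K] M, c φ * φ x ≠ 0 := by
    by_contra! h
    have hli := Fintype.linearIndependent_iff.1 (linearIndependent_toLinearMap K E M) c
      (LinearMap.ext fun x => by simpa using h x) (AlgHom.comp (1 : Gal(M/K)).toAlgHom E.val)
    rw [hc N.one_mem] at hli
    exact hw0 _ hli
  refine ⟨_, hx, fun σ hσ => ?_⟩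
  rw [map_sum, Finset.mul_sum,
    ← Equiv.sum_comp (AlgEquiv.arrowCongr (AlgEquiv.refl : E ≃ₐ[K] E) σ) (fun φ => c φ * φ x)]
  refine Finset.sum_congr rfl fun φ _ => ?_
  have h1 : AlgEquiv.arrowCongr (AlgEquiv.refl : E ≃ₐ[K] E) σ φ = σ.toAlgHom.comp φ := by
    ext x; rfl
  rw [h1, hcomp hσ, map_mul, mul_assoc]
  rfl

variable {p n : ℕ} [Fact p.Prime] {α : WittVector p M}

theorem isTranslation_zero_iff {σ : Gal(M/K)} :
    IsTranslation n ⊤ α σ 0 ↔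
      σ ∈ (IntermediateField.adjoin K (Set.range fun i : Fin n => α.coeff i)).fixingSubgroup := by
  rw [IntermediateField.mem_fixingSubgroup_iff]
  refine Iff.trans ?_ (IntermediateField.forall_mem_adjoin_smul_eq_self_iff K σ).symm
  rw [IsTranslation, Int.cast_zero, sub_zero, RingHom.mem_ker, map_sub, sub_eq_zero,
    TruncatedWittVector.ext_iff]
  simp only [coeff_truncate, map_coeff, Subgroup.mem_top, true_and, Set.forall_mem_range]
  rfl

theorem IsSplit.exists_cocycle_eq_one [Algebra.IsAlgebraic K M] {b : M}
    (hα : IsSplit n (⊤ : Subgroup Gal(M/K)) α b) :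
    ∃ u : Gal(M/K) → ℤ → M, (∀ σ m, u σ m ≠ 0) ∧
      (∀ σ m τ l, IsTranslation n ⊤ α σ m → IsTranslation n ⊤ α τ l →
        u (σ * τ) (m + l) = u σ m * σ (u τ l)) ∧
      (∀ σ, IsTranslation n ⊤ α σ 0 → u σ 0 = 1) ∧ u 1 (p ^ n : ℕ) = b := by
  obtain ⟨v, S, hS, hv0, hv, rfl, hvS⟩ := hα
  set L := IntermediateField.adjoin K (Set.range fun i : Fin n => α.coeff i)
  obtain ⟨z, hz0, hz⟩ := exists_mul_apply_eq_of_cocycle (N := L.fixingSubgroup)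
    (w := fun σ => v σ 0) hS (fun σ => hv0 σ 0)
    (fun σ hσ τ hτ => by
      simpa using hv σ 0 τ 0 (isTranslation_zero_iff.2 hσ) (isTranslation_zero_iff.2 hτ))
    (fun σ hσ => hvS σ (isTranslation_zero_iff.2 hσ))
  have hσz (σ : Gal(M/K)) : σ z ≠ 0 := by simpa using hz0
  refine ⟨fun σ m => v σ m * σ z / z, fun σ m => div_ne_zero (mul_ne_zero (hv0 _ _) (hσz σ)) hz0,
    fun σ m τ l hσ hτ => ?_, fun σ hσ => ?_, ?_⟩
  · beta_reduce
    have := hσz σ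
    rw [hv σ m τ l hσ hτ, AlgEquiv.smul_def, map_div₀, map_mul, AlgEquiv.mul_apply]
    field_simp
  · beta_reduce
    rw [hz σ (isTranslation_zero_iff.1 hσ), div_self hz0]
  · beta_reduce
    rw [AlgEquiv.one_apply, mul_div_cancel_right₀ _ hz0]


theorem IsSplit.exists_norm_eq [IsGalois K M] [CharP M p] {b : K}
    (hα : IsSplit n (⊤ : Subgroup Gal(M/K)) α (algebraMap K M b))
    (hex : ∀ σ : Gal(M/K), ∃ m, IsTranslation n ⊤ α σ m) :
    FiniteDimensional K (IntermediateField.adjoin K (Set.range fun i : Fin n => α.coeff i)) ∧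
      ∃ x : IntermediateField.adjoin K (Set.range fun i : Fin n => α.coeff i),
        x ≠ 0 ∧ Algebra.norm K x = b := by
  obtain ⟨u, hu0, hu, hu1, hub⟩ := hα.exists_cocycle_eq_one
  have hT0 {σ : Gal(M/K)} := isTranslation_zero_iff (n := n) (α := α) (σ := σ)
  set L := IntermediateField.adjoin K (Set.range fun i : Fin n => α.coeff i)
  have hfd : FiniteDimensional K L :=
    IntermediateField.finiteDimensional_adjoin fun x _ => Algebra.IsIntegral.isIntegral x
  refine ⟨hfd, ?_⟩
  have hnormal : L.fixingSubgroup.Normal := by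
    refine ⟨fun ν hν σ => ?_⟩
    obtain ⟨m, hm⟩ := hex σ
    rw [← hT0] at hν ⊢
    simpa using (hm.mul hν).mul hm.inv
  have hgal : IsGalois K L := by
    rw [← InfiniteGalois.fixedField_fixingSubgroup L]
    exact IsGalois.of_fixedField_normal_subgroup _
  obtain ⟨d, hd⟩ : ∃ d : ℕ, ∀ m : ℤ, (∃ σ : Gal(M/K), IsTranslation n ⊤ α σ m) ↔ (d : ℤ) ∣ m := by
    obtain ⟨d, hd⟩ := Int.subgroup_cyclic
      { carrier := {m : ℤ | ∃ σ : Gal(M/K), IsTranslation n ⊤ α σ m}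
        add_mem' := fun ⟨σ, hσ⟩ ⟨τ, hτ⟩ => ⟨σ * τ, hσ.mul hτ⟩
        zero_mem' := ⟨1, .one⟩
        neg_mem' := fun ⟨σ, hσ⟩ => ⟨σ⁻¹, hσ.inv⟩ }
    refine ⟨d.natAbs, fun m => ?_⟩
    rw [Int.natAbs_dvd, ← Int.mem_zmultiples_iff, AddSubgroup.zmultiples_eq_closure, ← hd]
    rfl
  obtain ⟨g, hg⟩ := (hd d).2 dvd_rfl
  obtain ⟨e, he⟩ : d ∣ p ^ n := by
    have := (hd (p ^ n : ℕ)).1 ⟨1, .one_of_dvd (by simp)⟩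
    exact_mod_cast this
  have hde : d * e ≠ 0 := he ▸ pow_ne_zero n (Fact.out (p := p.Prime)).ne_zero
  have hdeZ : (d * e : ℤ) = p ^ n := by exact_mod_cast he.symm
  have hd0 : (d : ℤ) ≠ 0 := by exact_mod_cast left_ne_zero_of_mul hde
  have hpow (j : ℕ) : u (g ^ j) (j * d) = ∏ i ∈ Finset.range j, (g ^ i) (u g d) := by
    induction j with
    | zero => simpa using hu1 1 .one
    | succ j ih =>
      rw [Finset.prod_range_succ, ← ih, ← hu _ _ _ _ (hg.pow j) hg, pow_succ]
      congr 1
      push_cast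
      ring
  have hge : u (g ^ e) (e * d) = algebraMap K M b := by
    have hg0 : IsTranslation n ⊤ α (g ^ e) 0 := (hg.pow e).of_dvd_sub ⟨-1, by rw [← hdeZ]; ring⟩
    have h := hu _ _ 1 (p ^ n : ℕ) hg0 (.one_of_dvd (by simp))
    rw [hu1 _ hg0, hub, mul_one, zero_add, one_mul, AlgEquiv.commutes] at h
    rw [← h, Nat.cast_pow, ← hdeZ, mul_comm]
  have hx : u g d ∈ L := by
    rw [← InfiniteGalois.fixedField_fixingSubgroup L, IntermediateField.mem_fixedField_iff]
    intro ν hν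
    have h1 := hu ν 0 g d (hT0.2 hν) hg
    have hν' := hT0.2 (hnormal.conj_mem ν hν g⁻¹)
    have h2 := hu g d _ 0 hg hν'
    rw [hu1 _ hν', map_one, mul_one] at h2
    rw [hu1 _ (hT0.2 hν), one_mul, zero_add] at h1
    rw [← h1, ← h2, add_zero]
    congr 1
    group
  have hbij : Function.Bijective fun j : Fin e => AlgEquiv.restrictNormalHom L (g ^ (j : ℕ)) := by
    have hdiff {σ : Gal(M/K)} {m : ℤ} (hσ : IsTranslation n ⊤ α σ m) (j : ℕ) :
        AlgEquiv.restrictNormalHom L (g ^ j) = AlgEquiv.restrictNormalHom L σ ↔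
          (d * e : ℤ) ∣ m - j * d := by
      have h := (hg.pow j).inv.mul hσ
      rw [neg_add_eq_sub] at h
      rw [eq_comm, MonoidHom.eq_iff, IntermediateField.restrictNormalHom_ker, ← hT0, hdeZ]
      refine ⟨fun h0 => ?_, fun h0 => h.of_dvd_sub ?_⟩
      · simpa using h.dvd_sub h0
      · rwa [zero_sub, dvd_neg]
    constructor
    · intro i j hij
      have := (hdiff (hg.pow j) i).1 hij
      rw [← sub_mul, mul_comm (d : ℤ), mul_dvd_mul_iff_right hd0] at this
      exact Fin.ext ((Nat.modEq_iff_dvd.2 this).eq_of_lt_of_lt i.2 j.2)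
    · intro τ
      obtain ⟨σ, rfl⟩ := AlgEquiv.restrictNormalHom_surjective M τ
      obtain ⟨m, hm⟩ := hex σ
      obtain ⟨l, rfl⟩ := (hd m).1 ⟨σ, hm⟩
      have he0 : (0 : ℤ) < e := by exact_mod_cast (right_ne_zero_of_mul hde).bot_lt
      have hl := Int.emod_nonneg l he0.ne'
      have hl' := Int.emod_lt_of_pos l he0
      refine ⟨⟨(l % e).toNat, by lia⟩, (hdiff hm _).2 ?_⟩
      rw [Int.toNat_of_nonneg hl, mul_comm _ (d : ℤ), ← mul_sub]
      exact mul_dvd_mul_left _ (Int.dvd_self_sub_emod)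
  refine ⟨⟨u g d, hx⟩, fun h => hu0 g d (congrArg Subtype.val h), ?_⟩
  apply (algebraMap K M).injective
  rw [IsScalarTower.algebraMap_apply K L M, Algebra.norm_eq_prod_automorphisms, map_prod,
    ← hbij.prod_comp, ← hge, hpow, Finset.prod_range]
  exact Finset.prod_congr rfl fun j _ => AlgEquiv.restrictNormal_commutes _ L _

end Norm

section Descent

open WittVector
open scoped Polynomial

variable {p n : ℕ} [Fact p.Prime] {k K : Type*} [Field k] [CharP k p] [PerfectRing k p] [Field K]
  [Algebra k K]

theorem exists_norm_eq_of_isSepClosed {M : Type*} [Field M] [Algebra K M] [IsGalois K M]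
    [IsSepClosed M] [CharP M p] {b : K} (hb : b ≠ 0) {a : WittVector p K}
    (ha : ∀ i < n, ∃ c ∈ Algebra.adjoin k ({b} : Set K), a.coeff i = b * c)
    {α : WittVector p M} (hα : frobenius α - α - map (algebraMap K M) a ∈ filtration p M n) :
    FiniteDimensional K (IntermediateField.adjoin K (Set.range fun i : Fin n => α.coeff i)) ∧
      ∃ x : IntermediateField.adjoin K (Set.range fun i : Fin n => α.coeff i),
        x ≠ 0 ∧ Algebra.norm K x = b := by
  let _ : Algebra k M := ((algebraMap K M).comp (algebraMap k K)).toAlgebra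
  have : IsScalarTower k K M := .of_algebraMap_eq' rfl
  have hpoly : ∀ i < n, ∃ P : k[X], a.coeff i = Polynomial.aeval b (Polynomial.X * P) := by
    intro i hi
    obtain ⟨c, hc, hac⟩ := ha i hi
    rw [Algebra.adjoin_singleton_eq_range_aeval] at hc
    obtain ⟨P, rfl⟩ := hc
    exact ⟨P, by rw [hac, map_mul, Polynomial.aeval_X]; rfl⟩
  choose! P hP using hpoly
  refine IsSplit.exists_norm_eq (polynomialSymbolsVanish (k := k) (M := M) (fun σ c => ?_) n ⊤
    (algebraMap K M b) ((_root_.map_ne_zero _).2 hb) (fun σ _ => ?_)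
    (WittVector.mk p fun i => Polynomial.X * P i) ?_ α ?_) fun σ =>
      IsTranslation.exists_int hα ?_ (Subgroup.mem_top σ)
  · exact σ.commutes _
  · exact σ.commutes b
  · ext i
    simp [map_coeff]
  · convert add_mem hα (mem_filtration_sub_iff.2 fun i hi => ?_) using 1
    · exact (sub_add_sub_cancel _ _ _).symm
    · rw [map_coeff, map_coeff, hP i hi, ← Polynomial.aeval_algebraMap_apply]
      rfl
  · exact mem_filtration_sub_iff.2 fun i _ => σ.commutes _

theorem exists_norm_eq_of_isAlgClosed {AC : Type*} [Field AC] [Algebra K AC] [IsAlgClosed AC]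
    [Algebra.IsAlgebraic K AC]
    {b : K} (hb : b ≠ 0) {a : WittVector p K}
    (ha : ∀ i < n, ∃ c ∈ Algebra.adjoin k ({b} : Set K), a.coeff i = b * c)
    {α : WittVector p AC} (hα : frobenius α - α - map (algebraMap K AC) a ∈ filtration p AC n) :
    FiniteDimensional K (IntermediateField.adjoin K (Set.range fun i : Fin n => α.coeff i)) ∧
      ∃ x : IntermediateField.adjoin K (Set.range fun i : Fin n => α.coeff i),
        x ≠ 0 ∧ Algebra.norm K x = b := by
  have : CharP K p := charP_of_injective_algebraMap (algebraMap k K).injective p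
  have : CharP AC p := charP_of_injective_algebraMap (algebraMap K AC).injective p
  let M := separableClosure K AC
  have : CharP M p := charP_of_injective_algebraMap (algebraMap K M).injective p
  have : IsSepClosed M := IsSepClosure.sep_closed K
  obtain ⟨γ, hγ⟩ := exists_frobenius_sub_sub_mem n (map (algebraMap K M) a)
  obtain ⟨m, hm⟩ := exists_intCast_of_frobenius_sub_mem (n := n)
    (x := α - map (algebraMap M AC) γ) <| by
      convert sub_mem hα (map_mem_filtration (algebraMap M AC) hγ) using 1
      have : map (algebraMap M AC) (map (algebraMap K M) a) = map (algebraMap K AC) a := rfl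
      rw [map_sub, map_sub, map_sub, this, frobenius_map]
      ring
  have hcoeff : ∀ i < n, α.coeff i = ((γ + m).coeff i : AC) := by
    rw [sub_sub, ← map_intCast (map (p := p) (algebraMap M AC)), ← map_add,
      mem_filtration_sub_iff] at hm
    exact hm
  obtain ⟨hfd, x, hx0, hx⟩ := exists_norm_eq_of_isSepClosed hb ha (α := γ + (m : WittVector p M))
    (by convert hγ using 1; rw [map_add, map_intCast]; ring)
  have hL : IntermediateField.adjoin K (Set.range fun i : Fin n => α.coeff i) =
      (IntermediateField.adjoin K (Set.range fun i : Fin n => (γ + m).coeff i)).map M.val := by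
    rw [IntermediateField.adjoin_map, ← Set.range_comp]
    congr 2
    ext i
    exact hcoeff i i.2
  rw [hL]
  let e := IntermediateField.equivMap
    (IntermediateField.adjoin K (Set.range fun i : Fin n => (γ + m).coeff i)) M.val
  refine ⟨.of_surjective e.toLinearMap e.surjective, e x, (map_ne_zero_iff e e.injective).2 hx0, ?_⟩
  rw [Algebra.norm_eq_of_algEquiv, hx]

end Descent

/-- Let `k` be a perfect field of characteristic `p`, `K/k` a field
extension, `n ≥ 1`, `b ∈ K`, `b ≠ 0`, and `a ∈ W_n(K)` with all coefficients in `b·k[b]`.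
If `Ω` is an algebraic closure of `K` and `α ∈ W_n(Ω)` satisfies `F(α) − α = a`
(coefficientwise, via the inclusion `K → Ω`), then the intermediate field
`L = K(α₀,…,α_{n−1})` is finite over `K` and `b` is a norm from `L`; that is, the
Artin–Schreier–Witt symbol `[a, b)_{p^n}` vanishes. -/
theorem artinSchreierWitt_symbol_vanishes_of_coeffs_in_bkb
    (p n : ℕ) [Fact p.Prime] (hn : 1 ≤ n)
    (k K AC : Type*) [Field k] [CharP k p] [PerfectRing k p]
    [Field K] [Algebra k K] [Field AC] [Algebra K AC] [IsAlgClosure K AC]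
    (b : K) (hb : b ≠ 0)
    (a : TruncatedWittVector p n K)
    (ha : ∀ i : Fin n, ∃ c ∈ Algebra.adjoin k ({b} : Set K), a.coeff i = b * c)
    (α : TruncatedWittVector p n AC)
    (hα : ∀ i : Fin n,
      (TruncatedWittVector.frob α - α).coeff i = algebraMap K AC (a.coeff i))
    (L : IntermediateField K AC)
    (hL : L = IntermediateField.adjoin K (Set.range fun i : Fin n => α.coeff i)) :
    FiniteDimensional K L ∧ ∃ x : L, x ≠ 0 ∧ Algebra.norm K x = b := by
  have : IsAlgClosed AC := IsAlgClosure.isAlgClosed K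
  have : Algebra.IsAlgebraic K AC := IsAlgClosure.isAlgebraic
  have hout : (fun i : Fin n => α.coeff i) = fun i : Fin n => α.out.coeff i :=
    funext fun i => (TruncatedWittVector.coeff_out α i).symm
  rw [hL, hout]
  refine exists_norm_eq_of_isAlgClosed (k := k) hb (a := a.out)
    (fun i hi => TruncatedWittVector.coeff_out a ⟨i, hi⟩ ▸ ha ⟨i, hi⟩)
    (WittVector.mem_filtration_sub_iff.2 fun i hi => ?_)
  have h := hα ⟨i, hi⟩
  have hα' : α = WittVector.truncate n α.out := (TruncatedWittVector.truncateFun_out α).symm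
  rw [TruncatedWittVector.frob, hα', ← map_sub, WittVector.coeff_truncate, ← hα'] at h
  rw [h, WittVector.map_coeff, ← TruncatedWittVector.coeff_out a ⟨i, hi⟩]
end
end

section
/- Let p be a prime, K a field of characteristic p, and n ≥ 1. In Ω¹(W_n(K)), for all a, b ∈ W_n(K) the element d(a) and the element V(a)·d(b) − a·d(F(b)) both belong to M'_n. -/
noncomputable section

namespace TruncatedWittVector

variable {p n : ℕ} [hp : Fact p.Prime] {R : Type*} [CommRing R]

/-- Verschiebung on truncated Witt vectors: `(x₀,…,x_{n-1}) ↦ (0,x₀,…,x_{n-2})`. -/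
def vers (x : TruncatedWittVector p n R) : TruncatedWittVector p n R :=
  WittVector.truncate n (WittVector.verschiebung x.out)

end TruncatedWittVector

namespace TruncatedWittVector

variable {p n : ℕ} [hp : Fact p.Prime] {R : Type*} [CommRing R]

lemma vers_truncate (x : WittVector p R) :
    vers (WittVector.truncate n x) = WittVector.truncate n (WittVector.verschiebung x) := by
  ext ⟨i, hi⟩
  rw [vers, WittVector.coeff_truncate, WittVector.coeff_truncate]
  cases i with
  | zero => simp only [WittVector.verschiebung_coeff_zero]
  | succ k =>
    have hk : k < n := Nat.lt_of_succ_lt hi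
    have h := coeff_out (WittVector.truncate n x) ⟨k, hk⟩
    rw [WittVector.coeff_truncate] at h
    simpa only [WittVector.verschiebung_coeff_succ] using h

lemma frob_truncate [CharP R p] (x : WittVector p R) :
    frob (WittVector.truncate n x) = WittVector.truncate n (WittVector.frobenius x) := by
  ext i
  have h := coeff_out (WittVector.truncate n x) i
  rw [WittVector.coeff_truncate] at h
  rw [frob, WittVector.coeff_truncate, WittVector.coeff_truncate,
    WittVector.coeff_frobenius_charP, WittVector.coeff_frobenius_charP, h]

lemma frob_one [CharP R p] : frob (1 : TruncatedWittVector p n R) = 1 := by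
  rw [← map_one (WittVector.truncate n), frob_truncate, map_one]

/-- The projection formula `V(a · F(b)) = V(a) · b`. -/
lemma vers_mul_frob [CharP R p] (a b : TruncatedWittVector p n R) :
    vers (a * frob b) = vers a * b := by
  obtain ⟨x, rfl⟩ := WittVector.truncate_surjective p n R a
  obtain ⟨y, rfl⟩ := WittVector.truncate_surjective p n R b
  rw [frob_truncate, ← map_mul, vers_truncate, vers_truncate, ← map_mul,
    WittVector.verschiebung_mul_frobenius]

lemma coeff_vers_iterate_of_lt (k : ℕ) (x : TruncatedWittVector p n R) (i : Fin n)
    (hi : (i : ℕ) < k) : (vers^[k] x).coeff i = 0 := by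
  induction k generalizing i with
  | zero => omega
  | succ k ih =>
    obtain ⟨i, hn⟩ := i
    rw [Function.iterate_succ_apply', vers, WittVector.coeff_truncate]
    cases i with
    | zero => exact WittVector.verschiebung_coeff_zero _
    | succ j =>
      have h := coeff_out (vers^[k] x) ⟨j, Nat.lt_of_succ_lt hn⟩
      rw [ih ⟨j, Nat.lt_of_succ_lt hn⟩ (Nat.lt_of_succ_lt_succ hi)] at h
      simpa only [WittVector.verschiebung_coeff_succ] using h

lemma vers_iterate_eq_zero (x : TruncatedWittVector p n R) : vers^[n] x = 0 := by
  ext i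
  rw [coeff_vers_iterate_of_lt n x i i.isLt, coeff_zero]

end TruncatedWittVector

/-- In `Ω¹(W_n(K))`, for all `a, b ∈ W_n(K)` the elements `d(a)` and
`V(a)·d(b) − a·d(F(b))` belong to `M'_n`, the additive subgroup generated by the
elements `F(x)·d(y) − x·d(V(y))` for `x, y ∈ W_n(K)`. -/
theorem da_and_Va_db_sub_a_dFb_mem_M'
    (p : ℕ) [Fact p.Prime] (K : Type*) [Field K] [CharP K p] (n : ℕ) (hn : 1 ≤ n) :
    ∀ a b : TruncatedWittVector p n K,
      KaehlerDifferential.D ℤ (TruncatedWittVector p n K) a ∈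
        AddSubgroup.closure
          {ω : Ω[TruncatedWittVector p n K⁄ℤ] |
            ∃ x y : TruncatedWittVector p n K,
              ω = TruncatedWittVector.frob x • KaehlerDifferential.D ℤ _ y -
                x • KaehlerDifferential.D ℤ _ (TruncatedWittVector.vers y)} ∧
      TruncatedWittVector.vers a • KaehlerDifferential.D ℤ (TruncatedWittVector p n K) b -
          a • KaehlerDifferential.D ℤ _ (TruncatedWittVector.frob b) ∈
        AddSubgroup.closure
          {ω : Ω[TruncatedWittVector p n K⁄ℤ] |
            ∃ x y : TruncatedWittVector p n K,
              ω = TruncatedWittVector.frob x • KaehlerDifferential.D ℤ _ y -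
                x • KaehlerDifferential.D ℤ _ (TruncatedWittVector.vers y)} := by
  intro a b
  set S := {ω : Ω[TruncatedWittVector p n K⁄ℤ] |
            ∃ x y : TruncatedWittVector p n K,
              ω = TruncatedWittVector.frob x • KaehlerDifferential.D ℤ _ y -
                x • KaehlerDifferential.D ℤ _ (TruncatedWittVector.vers y)}
  have hgen (x y : TruncatedWittVector p n K) :
      TruncatedWittVector.frob x • KaehlerDifferential.D ℤ _ y -
        x • KaehlerDifferential.D ℤ _ (TruncatedWittVector.vers y) ∈
          AddSubgroup.closure S :=
    AddSubgroup.subset_closure ⟨x, y, rfl⟩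
  have hone (y : TruncatedWittVector p n K) :
      KaehlerDifferential.D ℤ _ y - KaehlerDifferential.D ℤ _ (TruncatedWittVector.vers y) ∈
        AddSubgroup.closure S := by
    simpa only [TruncatedWittVector.frob_one, one_smul] using hgen 1 y
  have hiter (k : ℕ) : KaehlerDifferential.D ℤ _ a -
      KaehlerDifferential.D ℤ _ (TruncatedWittVector.vers^[k] a) ∈ AddSubgroup.closure S := by
    induction k with
    | zero => simp
    | succ k ih =>
      rw [Function.iterate_succ_apply']
      simpa only [sub_add_sub_cancel] using
        add_mem ih (hone (TruncatedWittVector.vers^[k] a))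
  refine ⟨?_, ?_⟩
  · simpa only [TruncatedWittVector.vers_iterate_eq_zero, map_zero, sub_zero] using hiter n
  · have h := sub_mem (hgen b a) (hone (a * TruncatedWittVector.frob b))
    rw [TruncatedWittVector.vers_mul_frob, Derivation.leibniz, Derivation.leibniz] at h
    convert h using 1
    abel
end
end
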